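/- arXiv:1903.01920 — 3 statements merged into one kernel-verified Lean document; each statement's English description precedes it below -/
import Mathlib

section
/- (Transitivity of strict preference, cases (i)/(iii) in the proof of the rationality lemma.) For all alternatives x, y, z : X, if better x y and better y z, then better x z. -/
/-- `better v x y` iff some criterion `i` favors `x` over `y` (`v i x < v i y`)
and all higher-priority criteria `j > i` are ties. -/
def better {X I : Type*} [LinearOrder I] (v : I → X → ℝ) (x y : X) : Prop :=
  ∃ i : I, v i x < v i y ∧ ∀ j : I, i < j → v j x = v j y

/-- Transitivity of the justified strict preference. -/
theorem better_trans {X I : Type*} [LinearOrder I] [Fintype I]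
    (v : I → X → ℝ) (x y z : X)
    (hxy : better v x y) (hyz : better v y z) : better v x z := by
  obtain ⟨i, hi, hi'⟩ := hxy
  obtain ⟨k, hk, hk'⟩ := hyz
  rcases lt_trichotomy i k with h | rfl | h
  · exact ⟨k, (hi' k h).trans_lt hk, fun j hj => (hi' j (h.trans hj)).trans (hk' j hj)⟩
  · exact ⟨i, hi.trans hk, fun j hj => (hi' j hj).trans (hk' j hj)⟩
  · exact ⟨i, hi.trans_eq (hk' i h), fun j hj => (hi' j hj).trans (hk' j (h.trans hj))⟩
end

section
/- (The epistemic component implements a rational preference relation.) Define the preference relation x ≿ y iff ¬ better y x. Then ≿ is a rational preference relation on X: it is complete (for all x y, x ≿ y or y ≿ x) and transitive (for all x y z, x ≿ y and y ≿ z imply x ≿ z). -/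
theorem better_asymm {X I : Type*} [LinearOrder I] {v : I → X → ℝ} {x y : X}
    (hxy : better v x y) : ¬ better v y x := by
  obtain ⟨i, hi, htie⟩ := hxy
  rintro ⟨j, hj, htie'⟩
  rcases lt_trichotomy i j with h | rfl | h
  · exact hj.ne' (htie j h)
  · exact hi.not_gt hj
  · exact hi.ne' (htie' i h)

theorem better_cotrans {X I : Type*} [LinearOrder I] [Finite I] {v : I → X → ℝ} {x z : X}
    (hxz : better v x z) (y : X) : better v x y ∨ better v y z := by
  obtain ⟨i, hi, htie⟩ := hxz
  -- Compare the three alternatives at the highest criterion where they are not all equal.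
  obtain ⟨m, hm, hmax⟩ : ∃ m, (v m x ≠ v m y ∨ v m y ≠ v m z) ∧
      ∀ j, m < j → v j x = v j y ∧ v j y = v j z := by
    have hne : {j | v j x ≠ v j y ∨ v j y ≠ v j z}.Nonempty := by
      refine ⟨i, ?_⟩
      by_contra h
      simp only [Set.mem_ofPred_eq, not_or, not_not] at h
      exact hi.ne (h.1.trans h.2)
    obtain ⟨m, hm⟩ := (Set.toFinite _).exists_maximal hne
    refine ⟨m, hm.prop, fun j hj => ?_⟩
    have h := hm.not_prop_of_gt hj
    simpa only [Set.mem_ofPred_eq, not_or, not_not] using h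
  have hle : v m x ≤ v m z := by
    rcases lt_trichotomy i m with h | rfl | h
    · exact (htie m h).le
    · exact hi.le
    · exact absurd ((hmax i h).1.trans (hmax i h).2) hi.ne
  by_cases hxy : v m x < v m y
  · exact Or.inl ⟨m, hxy, fun j hj => (hmax j hj).1⟩
  · refine Or.inr ⟨m, ?_, fun j hj => (hmax j hj).2⟩
    by_contra hyz
    rcases hm with h | h <;> apply h <;> linarith

/-- The epistemic component implements a rational preference relation:
`x ≿ y` iff `¬ better y x` is complete and transitive. -/
theorem pref_rational {X I : Type*} [LinearOrder I] [Fintype I]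
    (v : I → X → ℝ) (pref : X → X → Prop)
    (hpref : ∀ x y : X, pref x y ↔ ¬ better v y x) :
    (∀ x y : X, pref x y ∨ pref y x) ∧
      (∀ x y z : X, pref x y → pref y z → pref x z) := by
  simp only [hpref]
  refine ⟨fun x y => ?_, fun x y z hxy hyz hzx => ?_⟩
  · by_cases h : better v y x
    · exact Or.inr (better_asymm h)
    · exact Or.inl h
  · exact (better_cotrans hzx y).elim hyz hxy
end

section
/- (Theorem: the choice behavior of the abstract decision framework coincides with preference maximization.) Define the preference relation x ≿ y iff ¬ better y x. Then for every nonempty finite set B of alternatives, Λ(B) = C*(B,≿), i.e. the set of acceptable alternatives computed by the decision rules equals the set of ≿-maximal elements {x ∈ B | x ≿ y for all y ∈ B}. -/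
/-- The set of acceptable alternatives `Λ(B)` computed by Algorithm 1 from the
decision rules DR1 and DR2. -/
def acceptable {X I : Type*} [LinearOrder I] (v : I → X → ℝ) (B : Finset X) :
    Set X :=
  if B.card = 1 then ↑B
  else
    {w | w ∈ B ∧
      ((∃ y ∈ B, better v w y) ∧ (∀ z ∈ B, ¬ better v z w) ∨
        ∃ y ∈ B, y ≠ w ∧ ¬ better v w y ∧ ¬ better v y w ∧
          ∀ z ∈ B, ¬ (better v z w ∨ better v z y))}

/-- The set of preference-maximal choices `C*(B, ≿)`. -/
def prefMaxSet {X : Type*} (pref : X → X → Prop) (B : Set X) : Set X :=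
  {x ∈ B | ∀ y ∈ B, pref x y}

theorem eq_of_not_better {X I : Type*} [LinearOrder I] [Finite I] {v : I → X → ℝ} {x y : X}
    (hxy : ¬ better v x y) (hyx : ¬ better v y x) (i : I) : v i x = v i y := by
  induction i using (wellFounded_gt (α := I)).induction with
  | _ i ih =>
    rcases lt_trichotomy (v i x) (v i y) with h | h | h
    · exact absurd ⟨i, h, fun j hj => ih j hj⟩ hxy
    · exact h
    · exact absurd ⟨i, h, fun j hj => (ih j hj).symm⟩ hyx

theorem not_better_self {X I : Type*} [LinearOrder I] (v : I → X → ℝ) (x : X) :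
    ¬ better v x x :=
  fun ⟨_, h, _⟩ => lt_irrefl _ h

theorem better_congr_right {X I : Type*} [LinearOrder I] {v : I → X → ℝ} {x y : X}
    (h : ∀ i, v i x = v i y) (z : X) : better v z x ↔ better v z y := by
  simp only [better, h]

/-- The choice behavior of the abstract decision framework coincides with the
optimum one of the rational preference relation `x ≿ y :↔ ¬ better y x`. -/
theorem acceptable_eq_prefMaxSet {X I : Type*} [LinearOrder I] [Fintype I]
    (v : I → X → ℝ) (pref : X → X → Prop)
    (hpref : ∀ x y : X, pref x y ↔ ¬ better v y x)
    (B : Finset X) (hB : B.Nonempty) :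
    acceptable v B = prefMaxSet pref ↑B := by
  ext w
  simp only [acceptable, prefMaxSet, hpref, Set.mem_ofPred_eq, Finset.mem_coe]
  split_ifs with hcard
  · obtain ⟨a, rfl⟩ := Finset.card_eq_one.mp hcard
    simp only [Finset.coe_singleton, Set.mem_singleton_iff, Finset.mem_singleton, forall_eq]
    exact ⟨fun h => ⟨h, h ▸ not_better_self v w⟩, And.left⟩
  · refine and_congr_right fun hw => ⟨?_, fun hmax => ?_⟩
    · rintro (⟨-, h⟩ | ⟨y, -, -, -, -, h⟩)
      · exact h
      · exact fun z hz hzw => h z hz (Or.inl hzw)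
    · by_cases hdom : ∃ y ∈ B, better v w y
      · exact Or.inl ⟨hdom, hmax⟩
      · push Not at hdom
        have hone : 1 < B.card := lt_of_le_of_ne hB.card_pos (Ne.symm hcard)
        obtain ⟨y, hy, hyw⟩ := Finset.exists_mem_ne hone w
        have heq := eq_of_not_better (hdom y hy) (hmax y hy)
        refine Or.inr ⟨y, hy, hyw, hdom y hy, hmax y hy, fun z hz => ?_⟩
        rw [← better_congr_right heq, or_self]
        exact hmax z hz
end
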